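/- arXiv:2004.01119 — 3 statements merged into one kernel-verified Lean document; each statement's English description precedes it below -/
import Mathlib

section
/- Let X be a random vector in ℝⁿ, let q_X(x) = inf{P(X ∈ H) : H a closed half-space of ℝⁿ containing x}, let Λ_X(θ) = log E[e^{⟨θ,X⟩}] be its log-moment generating function and Λ*_X(x) = sup_{θ ∈ ℝⁿ} (⟨θ,x⟩ − Λ_X(θ)) its Legendre transform. Then for every x ∈ ℝⁿ, q_X(x) ≤ exp(−Λ*_X(x)). -/
open MeasureTheory ProbabilityTheory Set Pointwise Filter
open scoped ENNReal RealInnerProductSpace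

/-- A closed half-space of `ℝⁿ`. -/
def IsClosedHalfspace {n : ℕ} (H : Set (EuclideanSpace ℝ (Fin n))) : Prop :=
  ∃ (θ : EuclideanSpace ℝ (Fin n)) (c : ℝ), θ ≠ 0 ∧ H = {y | ⟪θ, y⟫ ≤ c}

/-- The half-space (Tukey) depth of a point w.r.t. a distribution `μ` on `ℝⁿ`:
`q_X(x) = inf {P(X ∈ H) : H a closed half-space containing x}`. -/
noncomputable def halfspaceDepth {n : ℕ} (μ : Measure (EuclideanSpace ℝ (Fin n)))
    (x : EuclideanSpace ℝ (Fin n)) : ℝ :=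
  sInf {r | ∃ H, IsClosedHalfspace H ∧ x ∈ H ∧ r = (μ H).toReal}

/-- The log-moment generating function `Λ_X(θ) = log E e^{⟨θ,X⟩}`, with values in `(-∞, +∞]`. -/
noncomputable def logMGF {n : ℕ} (μ : Measure (EuclideanSpace ℝ (Fin n)))
    (θ : EuclideanSpace ℝ (Fin n)) : EReal :=
  ENNReal.log (∫⁻ y, ENNReal.ofReal (Real.exp ⟪θ, y⟫) ∂μ)

/-- The Legendre transform `Λ*_X(x) = sup_θ (⟨θ,x⟩ - Λ_X(θ))` of the log-moment
generating function. -/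
noncomputable def legendreLogMGF {n : ℕ} (μ : Measure (EuclideanSpace ℝ (Fin n)))
    (x : EuclideanSpace ℝ (Fin n)) : EReal :=
  ⨆ θ : EuclideanSpace ℝ (Fin n), ((⟪θ, x⟫ : ℝ) : EReal) - logMGF μ θ

lemma depth_le_of_halfspace {n : ℕ} (μ : Measure (EuclideanSpace ℝ (Fin n)))
    [IsProbabilityMeasure μ] (x : EuclideanSpace ℝ (Fin n))
    (H : Set (EuclideanSpace ℝ (Fin n))) (hH : IsClosedHalfspace H) (hx : x ∈ H) :
    ENNReal.ofReal (halfspaceDepth μ x) ≤ μ H := by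
  apply ENNReal.ofReal_le_of_le_toReal
  apply csInf_le
  · refine ⟨0, ?_⟩
    rintro r ⟨H, _, _, rfl⟩
    exact ENNReal.toReal_nonneg
  · exact ⟨H, hH, hx, rfl⟩

lemma depth_le_one {n : ℕ} (μ : Measure (EuclideanSpace ℝ (Fin n)))
    [IsProbabilityMeasure μ] (x : EuclideanSpace ℝ (Fin n)) :
    ENNReal.ofReal (halfspaceDepth μ x) ≤ 1 := by
  by_cases h : ∃ H, IsClosedHalfspace H ∧ x ∈ H
  · obtain ⟨H, hH, hx⟩ := h
    exact (depth_le_of_halfspace μ x H hH hx).trans prob_le_one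
  · have : {r | ∃ H, IsClosedHalfspace H ∧ x ∈ H ∧ r = (μ H).toReal} = ∅ := by
      ext r
      simp only [mem_setOf_eq, mem_empty_iff_false, iff_false]
      rintro ⟨H, hH, hx, _⟩
      exact h ⟨H, hH, hx⟩
    simp [halfspaceDepth, this]

lemma depth_mul_le {n : ℕ} (μ : Measure (EuclideanSpace ℝ (Fin n)))
    [IsProbabilityMeasure μ] (x θ : EuclideanSpace ℝ (Fin n)) :
    ENNReal.ofReal (Real.exp ⟪θ, x⟫) * ENNReal.ofReal (halfspaceDepth μ x) ≤
      ∫⁻ y, ENNReal.ofReal (Real.exp ⟪θ, y⟫) ∂μ := by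
  by_cases h0 : θ = 0
  · subst h0
    simpa using depth_le_one μ x
  · have h1 := depth_le_of_halfspace μ x {y | ⟪-θ, y⟫ ≤ -⟪θ, x⟫}
      ⟨-θ, _, neg_ne_zero.mpr h0, rfl⟩ (by simp)
    have hm : Measurable fun y : EuclideanSpace ℝ (Fin n) =>
        ENNReal.ofReal (Real.exp ⟪θ, y⟫) := by fun_prop
    refine le_trans ?_ (mul_meas_ge_le_lintegral hm (ENNReal.ofReal (Real.exp ⟪θ, x⟫)))
    gcongr
    refine h1.trans (measure_mono ?_)
    intro y hy
    simp only [mem_setOf_eq, inner_neg_left, neg_le_neg_iff] at hy ⊢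
    exact ENNReal.ofReal_le_ofReal (Real.exp_le_exp.mpr hy)

/-- **Chebyshev bound on the depth.** For a random vector $X$ in $\mathbb{R}^n$,
$q_X(x) \le \exp(-\Lambda^*_X(x))$ for every $x$. -/
theorem halfspaceDepth_le_exp_neg_legendre {n : ℕ} {Ω : Type*} [MeasurableSpace Ω]
    (P : Measure Ω) [IsProbabilityMeasure P]
    (X : Ω → EuclideanSpace ℝ (Fin n)) (hX : Measurable X)
    (x : EuclideanSpace ℝ (Fin n)) :
    ENNReal.ofReal (halfspaceDepth (Measure.map X P) x)
      ≤ EReal.exp (-(legendreLogMGF (Measure.map X P) x)) := by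
  have := Measure.isProbabilityMeasure_map (μ := P) hX.aemeasurable
  set μ := Measure.map X P
  set D := ENNReal.ofReal (halfspaceDepth μ x) with hD
  suffices h : legendreLogMGF μ x ≤ -ENNReal.log D by
    rw [← ENNReal.exp_log D]
    exact EReal.exp_monotone (EReal.le_neg_of_le_neg h)
  refine iSup_le fun θ => ?_
  have h := ENNReal.log_monotone (depth_mul_le μ x θ)
  have hlog : ENNReal.log (ENNReal.ofReal (Real.exp ⟪θ, x⟫)) = ((⟪θ, x⟫ : ℝ) : EReal) := by
    rw [← EReal.exp_coe, EReal.log_exp]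
  rw [ENNReal.log_mul_add, hlog, ← hD] at h
  change _ ≤ logMGF μ θ at h
  have hDt : ENNReal.log D ≠ ⊤ := by
    rw [Ne, ENNReal.log_eq_top_iff]
    exact ENNReal.ofReal_ne_top
  generalize logMGF μ θ = L at *
  generalize ENNReal.log D = d at *
  generalize (⟪θ, x⟫ : ℝ) = a at *
  induction d
  · simp
  · induction L
    · simp [← EReal.coe_add] at h
    · norm_cast at *
      linarith
    · simp
  · exact absurd rfl hDt
end

section
/- Let X be a random vector in ℝⁿ, let q_X(x) = inf{P(X ∈ H) : H a closed half-space of ℝⁿ containing x}, and let Λ*_X be the Legendre transform of the log-moment generating function Λ_X(θ) = log E[e^{⟨θ,X⟩}]. Then for every α > 0, {x ∈ ℝⁿ : q_X(x) > e^{−α}} ⊆ {x ∈ ℝⁿ : Λ*_X(x) < α}. -/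
open MeasureTheory ProbabilityTheory Set Pointwise Filter
open scoped ENNReal RealInnerProductSpace

/-- **Superlevel sets of the depth are contained in sublevel sets of the Legendre
transform.** For a random vector $X$ in $\mathbb{R}^n$ and every $\alpha > 0$,
$\{x : q_X(x) > e^{-\alpha}\} \subseteq \{x : \Lambda^*_X(x) < \alpha\}$. -/
theorem halfspaceDepth_superlevel_subset_legendre_sublevel {n : ℕ} {Ω : Type*}
    [MeasurableSpace Ω] (P : Measure Ω) [IsProbabilityMeasure P]
    (X : Ω → EuclideanSpace ℝ (Fin n)) (hX : Measurable X)
    (α : ℝ) (hα : 0 < α) :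
    {x | Real.exp (-α) < halfspaceDepth (Measure.map X P) x}
      ⊆ {x | legendreLogMGF (Measure.map X P) x < (α : EReal)} := by
  intro x hx
  simp only [mem_setOf_eq] at hx ⊢
  set μ := Measure.map X P with hμ
  have hprob : IsProbabilityMeasure μ := Measure.isProbabilityMeasure_map hX.aemeasurable
  set q := halfspaceDepth μ x with hq
  have hq0 : 0 < q := lt_trans (Real.exp_pos _) hx
  have hlog : -Real.log q < α := by
    have := (Real.lt_log_iff_exp_lt hq0).2 hx
    linarith
  have hmax : ((max 0 (-Real.log q) : ℝ) : EReal) < (α : EReal) :=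
    EReal.coe_lt_coe_iff.2 (max_lt hα hlog)
  refine lt_of_le_of_lt (iSup_le fun θ => ?_) hmax
  by_cases hθ : θ = 0
  · subst hθ
    simp [logMGF]
  have hqH : q ≤ (μ {y | ⟪-θ, y⟫ ≤ ⟪-θ, x⟫}).toReal := by
    apply csInf_le
    · refine ⟨0, ?_⟩
      rintro r ⟨H, -, -, rfl⟩
      exact ENNReal.toReal_nonneg
    · exact ⟨_, ⟨-θ, ⟪-θ, x⟫, neg_ne_zero.2 hθ, rfl⟩, le_refl (⟪-θ, x⟫ : ℝ), rfl⟩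
  have hqH' : ENNReal.ofReal q ≤ μ {y | ⟪-θ, y⟫ ≤ ⟪-θ, x⟫} :=
    ENNReal.ofReal_le_of_le_toReal hqH
  have hset : {y : EuclideanSpace ℝ (Fin n) | ⟪-θ, y⟫ ≤ ⟪-θ, x⟫} ⊆
      {y | ENNReal.ofReal (Real.exp ⟪θ, x⟫) ≤ ENNReal.ofReal (Real.exp ⟪θ, y⟫)} := by
    intro y hy
    simp only [mem_setOf_eq, inner_neg_left, neg_le_neg_iff] at hy ⊢
    exact ENNReal.ofReal_le_ofReal (Real.exp_le_exp.2 hy)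
  have hM : ENNReal.ofReal (Real.exp (⟪θ, x⟫ + Real.log q)) ≤
      ∫⁻ y, ENNReal.ofReal (Real.exp ⟪θ, y⟫) ∂μ := by
    rw [Real.exp_add, Real.exp_log hq0, ENNReal.ofReal_mul (Real.exp_pos _).le]
    refine le_trans (mul_le_mul_right (hqH'.trans (measure_mono hset)) _) ?_
    exact mul_meas_ge_le_lintegral (by fun_prop) _
  have hL : ((⟪θ, x⟫ + Real.log q : ℝ) : EReal) ≤ logMGF μ θ := by
    have h := ENNReal.log_monotone hM
    rwa [ENNReal.log_ofReal_of_pos (Real.exp_pos _), Real.log_exp] at h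
  calc ((⟪θ, x⟫ : ℝ) : EReal) - logMGF μ θ
      ≤ ((⟪θ, x⟫ : ℝ) : EReal) - ((⟪θ, x⟫ + Real.log q : ℝ) : EReal) :=
        EReal.sub_le_sub le_rfl hL
    _ = ((-Real.log q : ℝ) : EReal) := by
        rw [← EReal.coe_sub]; congr 1; ring
    _ ≤ _ := EReal.coe_le_coe_iff.2 (le_max_right _ _)
end

section
/- Let κ ∈ (0,1), b > 0, and let g : ℝ → [0, +∞) be a probability density supported in [−b, b] such that g^{κ/(1−κ)} is concave on [−b, b]. Then for every a ∈ [0, b], ∫_a^b g(t) dt ≥ κ · g(0) · b · (1 − a/b)^{1/κ}. -/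
open MeasureTheory Set

/-- **One-dimensional lemma.** Let `κ ∈ (0,1)`, `b > 0`, and let `g` be a probability
density supported in `[-b, b]` such that `g^{κ/(1-κ)}` is concave on `[-b, b]`. Then for
every `a ∈ [0, b]`, `∫_a^b g(t) dt ≥ κ g(0) b (1 - a/b)^{1/κ}`. -/
theorem concave_power_density_integral_lower_bound
    (κ b : ℝ) (hκ : κ ∈ Set.Ioo (0 : ℝ) 1) (hb : 0 < b)
    (g : ℝ → ℝ) (hgm : Measurable g) (hg0 : ∀ t, 0 ≤ g t)
    (hgint : ∫ t, g t = 1)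
    (hgsupp : ∀ t, t ∉ Set.Icc (-b) b → g t = 0)
    (hconc : ConcaveOn ℝ (Set.Icc (-b) b) (fun t => g t ^ (κ / (1 - κ)))) :
    ∀ a ∈ Set.Icc (0 : ℝ) b,
      κ * g 0 * b * (1 - a / b) ^ (1 / κ) ≤ ∫ t in a..b, g t := by
  intro a ha
  obtain ⟨hκ0, hκ1⟩ := hκ
  obtain ⟨ha0, hab⟩ := ha
  have h1κ : 0 < 1 - κ := by linarith
  have hp : 0 < κ / (1 - κ) := div_pos hκ0 h1κ
  have hr : 0 < (1 - κ) / κ := div_pos h1κ hκ0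
  have hpr : κ / (1 - κ) * ((1 - κ) / κ) = 1 := by field_simp
  have hgi : Integrable g := by
    by_contra h
    rw [integral_undef h] at hgint
    exact zero_ne_one hgint
  have key : ∀ t ∈ Set.Icc a b, g 0 * (1 - t / b) ^ ((1 - κ) / κ) ≤ g t := by
    rintro t ⟨hta, htb⟩
    have ht0 : 0 ≤ t / b := div_nonneg (ha0.trans hta) hb.le
    have ht1 : t / b ≤ 1 := (div_le_one hb).2 htb
    have h0 : (0 : ℝ) ∈ Set.Icc (-b) b := ⟨by linarith, hb.le⟩
    have h1 : b ∈ Set.Icc (-b) b := ⟨by linarith, le_rfl⟩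
    have hc := hconc.2 h0 h1 (sub_nonneg.2 ht1) ht0 (by ring)
    have he : (1 - t / b) • (0 : ℝ) + (t / b) • b = t := by
      simp only [smul_eq_mul]; field_simp; ring
    rw [he] at hc
    simp only [smul_eq_mul] at hc
    have hB : 0 ≤ t / b * g b ^ (κ / (1 - κ)) := mul_nonneg ht0 (Real.rpow_nonneg (hg0 b) _)
    have hle : (1 - t / b) * g 0 ^ (κ / (1 - κ)) ≤ g t ^ (κ / (1 - κ)) := by linarith
    have hP : 0 ≤ g 0 ^ (κ / (1 - κ)) := Real.rpow_nonneg (hg0 0) _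
    have h2 := Real.rpow_le_rpow (mul_nonneg (sub_nonneg.2 ht1) hP) hle hr.le
    rw [Real.mul_rpow (sub_nonneg.2 ht1) hP, ← Real.rpow_mul (hg0 0), ← Real.rpow_mul (hg0 t),
      hpr, Real.rpow_one, Real.rpow_one] at h2
    linarith
  have hcomp : ∫ t in a..b, g 0 * (1 - t / b) ^ ((1 - κ) / κ)
      = κ * g 0 * b * (1 - a / b) ^ (1 / κ) := by
    rw [intervalIntegral.integral_const_mul,
      intervalIntegral.integral_comp_sub_div (fun x => x ^ ((1 - κ) / κ)) hb.ne' 1,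
      integral_rpow (Or.inl (by linarith))]
    have e : (1 - κ) / κ + 1 = 1 / κ := by field_simp; ring
    rw [e, div_self hb.ne', sub_self, Real.zero_rpow (by positivity)]
    simp only [smul_eq_mul]
    field_simp
    ring
  rw [← hcomp]
  refine intervalIntegral.integral_mono_on hab ?_ hgi.intervalIntegrable key
  apply Continuous.intervalIntegrable
  exact continuous_const.mul
    ((continuous_const.sub (continuous_id.div_const b)).rpow_const fun _ => Or.inr hr.le)
end
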